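/- arXiv:2102.10025 — 5 statements merged into one kernel-verified Lean document; each statement's English description precedes it below -/
import Mathlib

section
/- Let α ≥ 1/2, θ ∈ ℝ and S > θ + 1. If α ≥ 1, then C₀·(1/(α(S−θ)^{α−1}) − (α−1)/(α²(S−θ)^{2α−1}))·exp(−(S−θ)^α) ≤ P_θ(S) ≤ (C₀/(α(S−θ)^{α−1}))·exp(−(S−θ)^α). If 1/2 ≤ α < 1, then (C₀/(α(S−θ)^{α−1}))·exp(−(S−θ)^α) ≤ P_θ(S) ≤ C₀·(1/(α(S−θ)^{α−1}) + (1−α)/(α²(S−θ)^{2α−1}))·exp(−(S−θ)^α). -/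
open MeasureTheory Filter Set Topology

/-- Normalization constant `C₀ = (∫ exp(-|x|^α) dx)⁻¹`. -/
noncomputable def C0 (α : ℝ) : ℝ := (∫ x : ℝ, Real.exp (-(|x| ^ α)))⁻¹

/-- Density `f_θ(x) = C₀ exp(-|x-θ|^α)`. -/
noncomputable def fd (α θ x : ℝ) : ℝ := C0 α * Real.exp (-(|x - θ| ^ α))

/-- Tail probability `P_θ(S) = ∫_S^∞ f_θ(x) dx`. -/
noncomputable def Ptail (α θ S : ℝ) : ℝ := ∫ x in Set.Ioi S, fd α θ x

/-- Conditional mean above `S`: `μ_θ(S) = (∫_S^∞ x f_θ(x) dx) / P_θ(S)`. -/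
noncomputable def muTail (α θ S : ℝ) : ℝ := (∫ x in Set.Ioi S, x * fd α θ x) / Ptail α θ S

/-- `g_θ(S) = P_θ(S) / ∫_S^∞ P_θ(x) dx`. -/
noncomputable def gfun (α θ S : ℝ) : ℝ := Ptail α θ S / ∫ x in Set.Ioi S, Ptail α θ x

/-- Hazard rate `h_θ(S) = f_θ(S)/P_θ(S)`. -/
noncomputable def hazard (α θ S : ℝ) : ℝ := fd α θ S / Ptail α θ S

lemma integrableOn_rpow_mul_exp_neg_rpow_Ioi_of_nonpos {α u s : ℝ} (hα : 0 < α) (hu : 1 ≤ u)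
    (hs : s ≤ 0) : IntegrableOn (fun x : ℝ => x ^ s * Real.exp (-(x ^ α))) (Ioi u) := by
  have h0 : IntegrableOn (fun x : ℝ => Real.exp (-(x ^ α))) (Ioi u) := by
    have h := integrableOn_rpow_mul_exp_neg_rpow (p := α) (s := 0) (by norm_num) hα
    simp only [Real.rpow_zero, one_mul] at h
    exact h.mono_set (Ioi_subset_Ioi (by linarith))
  refine Integrable.mono' h0 (by fun_prop) ?_
  refine (ae_restrict_iff' measurableSet_Ioi).mpr (Eventually.of_forall fun x hx => ?_)
  have hx1 : 1 ≤ x := hu.trans (le_of_lt hx)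
  have hx0 : 0 ≤ x := by linarith
  rw [Real.norm_of_nonneg (by positivity)]
  exact mul_le_of_le_one_left (Real.exp_pos _).le (Real.rpow_le_one_of_one_le_of_nonpos hx1 hs)

lemma tendsto_rpow_mul_exp_neg_rpow_atTop {α : ℝ} (hα : 0 < α) (s : ℝ) :
    Tendsto (fun x : ℝ => x ^ s * Real.exp (-(x ^ α))) atTop (𝓝 0) := by
  have h := (tendsto_rpow_mul_exp_neg_mul_atTop_nhds_zero (s / α) 1 one_pos).comp
    (tendsto_rpow_atTop hα)
  refine h.congr' ?_
  filter_upwards [eventually_ge_atTop 0] with x hx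
  simp only [Function.comp_apply]
  rw [← Real.rpow_mul hx, mul_div_cancel₀ s hα.ne', neg_one_mul]

/-- Integration by parts for the upper incomplete moments of `exp (-x ^ α)`. -/
lemma rpow_mul_exp_neg_rpow_eq_integral {α u s : ℝ} (hα : 0 < α) (hu : 1 ≤ u)
    (hsα : s + α ≤ 1) :
    u ^ s * Real.exp (-(u ^ α)) =
      α * (∫ x in Ioi u, x ^ (s + α - 1) * Real.exp (-(x ^ α))) -
        s * ∫ x in Ioi u, x ^ (s - 1) * Real.exp (-(x ^ α)) := by
  have h1 := integrableOn_rpow_mul_exp_neg_rpow_Ioi_of_nonpos hα hu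
    (show s + α - 1 ≤ 0 by linarith)
  have h2 := integrableOn_rpow_mul_exp_neg_rpow_Ioi_of_nonpos hα hu
    (show s - 1 ≤ 0 by linarith)
  have hderiv : ∀ x ∈ Ici u, HasDerivAt (fun x : ℝ => x ^ s * Real.exp (-(x ^ α)))
      (s * (x ^ (s - 1) * Real.exp (-(x ^ α))) -
        α * (x ^ (s + α - 1) * Real.exp (-(x ^ α)))) x := by
    intro x hx
    have hx0 : 0 < x := by have := mem_Ici.mp hx; linarith
    refine ((Real.hasDerivAt_rpow_const (p := s) (Or.inl hx0.ne')).mul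
      (Real.hasDerivAt_rpow_const (p := α) (Or.inl hx0.ne')).neg.exp).congr_deriv ?_
    rw [show s + α - 1 = s + (α - 1) by ring, Real.rpow_add hx0 s]
    simp only [Pi.neg_apply]
    ring
  have h := integral_Ioi_of_hasDerivAt_of_tendsto' hderiv
    ((h2.const_mul s).sub (h1.const_mul α)) (tendsto_rpow_mul_exp_neg_rpow_atTop hα s)
  rw [integral_sub (h2.const_mul s) (h1.const_mul α), integral_const_mul,
    integral_const_mul] at h
  linarith

lemma C0_nonneg (α : ℝ) : 0 ≤ C0 α :=
  inv_nonneg.mpr (integral_nonneg fun _ => (Real.exp_pos _).le)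

lemma Ptail_eq {α θ S : ℝ} (hS : θ ≤ S) :
    Ptail α θ S = C0 α * ∫ x in Ioi (S - θ), Real.exp (-(x ^ α)) := by
  have hshift : ∫ x in Ioi S, Real.exp (-(|x - θ| ^ α)) =
      ∫ x in Ioi (S - θ), Real.exp (-(|x| ^ α)) := by
    have h := (measurePreserving_sub_right volume θ).setIntegral_preimage_emb
      (measurableEmbedding_subRight θ) (fun x : ℝ => Real.exp (-(|x| ^ α))) (Ioi (S - θ))
    simpa using h
  unfold Ptail fd
  rw [integral_const_mul, hshift]
  congr 1
  refine setIntegral_congr_fun measurableSet_Ioi fun x hx => ?_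
  have hx0 : 0 ≤ x := by have := mem_Ioi.mp hx; linarith
  simp only [abs_of_nonneg hx0]

/-- Bounds on the tail probability (Lemma "Bounds on Tailed Probability"). -/
theorem stmt_0 (α θ S : ℝ) (hα : 1/2 ≤ α) (hS : S > θ + 1) :
    (1 ≤ α →
      C0 α * (1 / (α * (S - θ) ^ (α - 1)) - (α - 1) / (α ^ 2 * (S - θ) ^ (2 * α - 1)))
          * Real.exp (-((S - θ) ^ α)) ≤ Ptail α θ S ∧
      Ptail α θ S ≤ C0 α / (α * (S - θ) ^ (α - 1)) * Real.exp (-((S - θ) ^ α))) ∧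
    (α < 1 →
      C0 α / (α * (S - θ) ^ (α - 1)) * Real.exp (-((S - θ) ^ α)) ≤ Ptail α θ S ∧
      Ptail α θ S ≤ C0 α * (1 / (α * (S - θ) ^ (α - 1)) + (1 - α) / (α ^ 2 * (S - θ) ^ (2 * α - 1)))
          * Real.exp (-((S - θ) ^ α))) := by
  have hα0 : 0 < α := by linarith
  have hu : 1 ≤ S - θ := by linarith
  rw [Ptail_eq (by linarith)]
  have hC := C0_nonneg α
  set u := S - θ
  have hu0 : 0 < u := by linarith
  have h1 := rpow_mul_exp_neg_rpow_eq_integral (s := 1 - α) hα0 hu (by linarith)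
  have h2 := rpow_mul_exp_neg_rpow_eq_integral (s := 1 - 2 * α) hα0 hu (by linarith)
  rw [show 1 - α + α - 1 = 0 by ring, show 1 - α - 1 = -α by ring,
    show 1 - α = -(α - 1) by ring, Real.rpow_neg hu0.le] at h1
  rw [show 1 - 2 * α + α - 1 = -α by ring, show 1 - 2 * α = -(2 * α - 1) by ring,
    Real.rpow_neg hu0.le] at h2
  simp only [Real.rpow_zero, one_mul] at h1
  have moment_nonneg (s : ℝ) : 0 ≤ ∫ x in Ioi u, x ^ s * Real.exp (-(x ^ α)) := by
    refine setIntegral_nonneg measurableSet_Ioi fun x hx => ?_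
    have : 0 < x := hu0.trans hx
    positivity
  have hJ := moment_nonneg (-α)
  have hK := moment_nonneg (-(2 * α - 1) - 1)
  set I := ∫ x in Ioi u, Real.exp (-(x ^ α))
  set J := ∫ x in Ioi u, x ^ (-α) * Real.exp (-(x ^ α))
  set K := ∫ x in Ioi u, x ^ (-(2 * α - 1) - 1) * Real.exp (-(x ^ α))
  set E := Real.exp (-(u ^ α))
  have first : 1 / (α * u ^ (α - 1)) * E = I + (α - 1) / α * J := by
    rw [one_div, mul_inv, mul_assoc, h1]
    field_simp
    ring
  have second (c : ℝ) : c / (α ^ 2 * u ^ (2 * α - 1)) * E =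
      c / α * J + c * (2 * α - 1) / α ^ 2 * K := by
    rw [div_eq_mul_inv, mul_inv, mul_assoc, mul_assoc, h2]
    field_simp
    ring
  have hleading : C0 α / (α * u ^ (α - 1)) * E = C0 α * (I + (α - 1) / α * J) := by
    rw [← first]; ring
  have hα2 : 0 ≤ 2 * α - 1 := by linarith
  rw [hleading]
  refine ⟨fun h => ?_, fun h => ?_⟩
  · have hsub : 0 ≤ α - 1 := by linarith
    have hJ' : 0 ≤ (α - 1) / α * J := by positivity
    have hK' : 0 ≤ (α - 1) * (2 * α - 1) / α ^ 2 * K := by positivity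
    rw [mul_assoc, sub_mul, first, second]
    exact ⟨mul_le_mul_of_nonneg_left (by linarith) hC,
      mul_le_mul_of_nonneg_left (by linarith) hC⟩
  · have hsub : 0 ≤ 1 - α := by linarith
    have hJ' : 0 ≤ (1 - α) / α * J := by positivity
    have hK' : 0 ≤ (1 - α) * (2 * α - 1) / α ^ 2 * K := by positivity
    have hneg : (α - 1) / α * J = -((1 - α) / α * J) := by ring
    rw [mul_assoc, add_mul, first, second, hneg]
    exact ⟨mul_le_mul_of_nonneg_left (by linarith) hC,
      mul_le_mul_of_nonneg_left (by linarith) hC⟩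
end

section
/- Let α ≥ 1/2. For any θ ∈ ℝ, h_θ(S)/(α·(S−θ)^{α−1}) → 1 and g_θ(S)/(α·(S−θ)^{α−1}) → 1 as S → ∞. Moreover the convergence is uniform in θ in the following sense: sup_{θ∈ℝ} |h_θ(θ+T)/(α·T^{α−1}) − 1| → 0 and sup_{θ∈ℝ} |g_θ(θ+T)/(α·T^{α−1}) − 1| → 0 as T → ∞. -/
open MeasureTheory Filter Set Topology

/-- A continuous positive function that decays faster than every power and whose logarithmic
derivative is asymptotic to `-α x^(α-1)`. -/
structure HasWeibullDecay (α : ℝ) (f f' : ℝ → ℝ) : Prop where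
  continuous : Continuous f
  pos : ∀ x, 0 < f x
  hasDerivAt : ∀ᶠ x in atTop, HasDerivAt f (f' x) x
  tendsto_logDeriv : Tendsto (fun x => f' x / (f x * x ^ (α - 1))) atTop (𝓝 (-α))
  tendsto_rpow_mul : ∀ s : ℝ, Tendsto (fun x => x ^ s * f x) atTop (𝓝 0)

section IntegralTail

variable {f : ℝ → ℝ}

theorem hasDerivAt_integral_Ioi (hf : Continuous f) (hi : ∀ a, IntegrableOn f (Ioi a)) (x : ℝ) :
    HasDerivAt (fun T => ∫ y in Ioi T, f y) (-f x) x := by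
  have h : (fun T => ∫ y in Ioi T, f y) =
      fun T => (∫ y in Ioi (0 : ℝ), f y) - ∫ y in (0 : ℝ)..T, f y := by
    funext T
    rw [← intervalIntegral.integral_interval_add_Ioi (hi 0) (hi T)]
    ring
  rw [h]
  exact (intervalIntegral.integral_hasDerivAt_right (hf.intervalIntegrable _ _)
    (hf.stronglyMeasurableAtFilter _ _) hf.continuousAt).const_sub _

theorem tendsto_integral_Ioi_atTop_zero (hi : ∀ a, IntegrableOn f (Ioi a)) :
    Tendsto (fun T => ∫ y in Ioi T, f y) atTop (𝓝 0) := by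
  have h : (fun T => ∫ y in Ioi T, f y) =
      fun T => (∫ y in Ioi (0 : ℝ), f y) - ∫ y in (0 : ℝ)..T, f y := by
    funext T
    rw [← intervalIntegral.integral_interval_add_Ioi (hi 0) (hi T)]
    ring
  rw [h]
  simpa using (intervalIntegral_tendsto_integral_Ioi 0 (hi 0) tendsto_id).const_sub
    (∫ y in Ioi (0 : ℝ), f y)

theorem integral_Ioi_pos_of_pos (hf : ∀ x, 0 < f x) (hi : ∀ a, IntegrableOn f (Ioi a)) (x : ℝ) :
    0 < ∫ y in Ioi x, f y := by
  rw [setIntegral_pos_iff_support_of_nonneg_ae (ae_of_all _ fun y => (hf y).le) (hi x)]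
  have h : Function.support f = univ := by
    ext y
    simp [(hf y).ne']
  simp [h]

end IntegralTail

namespace HasWeibullDecay

variable {α : ℝ} {f f' : ℝ → ℝ}

theorem integrableOn_Ioi (h : HasWeibullDecay α f f') (a : ℝ) : IntegrableOn f (Ioi a) := by
  refine IntegrableOn.mono_set ?_ Ioi_subset_Ici_self
  refine (h.continuous.locallyIntegrable.locallyIntegrableOn _).integrableOn_of_isBigO_atTop
    (g := fun x => x ^ (-2 : ℝ)) ?_ (integrableAtFilter_rpow_atTop_iff.mpr (by norm_num))
  refine Asymptotics.IsBigO.of_bound 1 ?_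
  filter_upwards [(h.tendsto_rpow_mul 2).eventually (gt_mem_nhds one_pos),
    eventually_gt_atTop 0] with x hx hx0
  have h2 : 0 < x ^ (2 : ℝ) := Real.rpow_pos_of_pos hx0 _
  rw [Real.norm_of_nonneg (h.pos x).le, Real.norm_of_nonneg (Real.rpow_nonneg hx0.le _),
    Real.rpow_neg hx0.le, one_mul, ← one_div, le_div_iff₀ h2, mul_comm]
  exact hx.le

theorem tendsto_div_integral_Ioi (h : HasWeibullDecay α f f') (hα : 0 < α) :
    Tendsto (fun x => x ^ (1 - α) * f x / ∫ y in Ioi x, f y) atTop (𝓝 α) := by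
  have hlim : Tendsto (fun x => -(f' x / (f x * x ^ (α - 1)) + (1 - α) * x ^ (-α))) atTop
      (𝓝 α) := by
    simpa using (h.tendsto_logDeriv.add
      ((tendsto_rpow_neg_atTop hα).const_mul (1 - α))).neg
  refine HasDerivAt.lhopital_zero_atTop
    (f' := fun x => (1 - α) * x ^ (1 - α - 1) * f x + x ^ (1 - α) * f' x)
    (g' := fun x => -f x) ?_
    (Eventually.of_forall fun x => hasDerivAt_integral_Ioi h.continuous h.integrableOn_Ioi x)
    (Eventually.of_forall fun x => neg_ne_zero.mpr (h.pos x).ne')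
    (h.tendsto_rpow_mul _) (tendsto_integral_Ioi_atTop_zero h.integrableOn_Ioi) ?_
  · filter_upwards [h.hasDerivAt, eventually_gt_atTop 0] with x hx hx0
    exact (Real.hasDerivAt_rpow_const (Or.inl hx0.ne')).mul hx
  · refine hlim.congr' ?_
    filter_upwards [eventually_gt_atTop 0] with x hx0
    have hf := (h.pos x).ne'
    rw [show 1 - α - 1 = -α by ring, show 1 - α = -(α - 1) by ring, Real.rpow_neg hx0.le (α - 1)]
    have hp := (Real.rpow_pos_of_pos hx0 (α - 1)).ne'
    field_simp
    ring

theorem integral_Ioi (h : HasWeibullDecay α f f') (hα : 0 < α) :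
    HasWeibullDecay α (fun x => ∫ y in Ioi x, f y) (fun x => -f x) where
  continuous := continuous_iff_continuousAt.mpr fun x =>
    (hasDerivAt_integral_Ioi h.continuous h.integrableOn_Ioi x).continuousAt
  pos := integral_Ioi_pos_of_pos h.pos h.integrableOn_Ioi
  hasDerivAt :=
    Eventually.of_forall fun x => hasDerivAt_integral_Ioi h.continuous h.integrableOn_Ioi x
  tendsto_logDeriv := by
    refine (h.tendsto_div_integral_Ioi hα).neg.congr' ?_
    filter_upwards [eventually_gt_atTop 0] with x hx0
    have hF := (integral_Ioi_pos_of_pos h.pos h.integrableOn_Ioi x).ne'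
    have hp := (Real.rpow_pos_of_pos hx0 (α - 1)).ne'
    rw [show 1 - α = -(α - 1) by ring, Real.rpow_neg hx0.le]
    field_simp
  tendsto_rpow_mul s := by
    have hlim := (h.tendsto_rpow_mul (s + (1 - α))).div (h.tendsto_div_integral_Ioi hα) hα.ne'
    rw [zero_div] at hlim
    refine hlim.congr' ?_
    filter_upwards [eventually_gt_atTop 0] with x hx0
    have hf := (h.pos x).ne'
    have hF := (integral_Ioi_pos_of_pos h.pos h.integrableOn_Ioi x).ne'
    have hp := (Real.rpow_pos_of_pos hx0 (1 - α)).ne'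
    simp only [Pi.div_apply]
    rw [Real.rpow_add hx0]
    field_simp

theorem tendsto_ratio (h : HasWeibullDecay α f f') (hα : 0 < α) :
    Tendsto (fun x => (f x / ∫ y in Ioi x, f y) / (α * x ^ (α - 1))) atTop (𝓝 1) := by
  have hlim := (h.tendsto_div_integral_Ioi hα).div_const α
  rw [div_self hα.ne'] at hlim
  refine hlim.congr' ?_
  filter_upwards [eventually_gt_atTop 0] with x hx0
  have hp := (Real.rpow_pos_of_pos hx0 (α - 1)).ne'
  rw [show 1 - α = -(α - 1) by ring, Real.rpow_neg hx0.le]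
  field_simp

end HasWeibullDecay

theorem C0_pos {α : ℝ} (hα : 0 < α) : 0 < C0 α := by
  rw [C0, integral_comp_abs (f := fun x => Real.exp (-(x ^ α))), integral_exp_neg_rpow hα]
  have := Real.Gamma_pos_of_pos (show 0 < 1 / α + 1 by positivity)
  positivity

theorem hasWeibullDecay_fd {α : ℝ} (hα : 0 < α) :
    HasWeibullDecay α (fd α 0) (fun x => -α * x ^ (α - 1) * fd α 0 x) where
  continuous := by
    unfold fd
    exact continuous_const.mul (Real.continuous_exp.comp
      (((continuous_id.sub continuous_const).abs.rpow_const fun _ => Or.inr hα.le).neg))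
  pos x := mul_pos (C0_pos hα) (Real.exp_pos _)
  hasDerivAt := by
    filter_upwards [eventually_gt_atTop 0] with x hx0
    have hd : HasDerivAt (fun y => C0 α * Real.exp (-(y ^ α)))
        (C0 α * (Real.exp (-(x ^ α)) * -(α * x ^ (α - 1)))) x :=
      ((Real.hasDerivAt_rpow_const (Or.inl hx0.ne')).neg.exp).const_mul _
    have he : fd α 0 =ᶠ[𝓝 x] fun y => C0 α * Real.exp (-(y ^ α)) := by
      filter_upwards [lt_mem_nhds hx0] with y hy
      simp [fd, abs_of_pos hy]
    refine (hd.congr_of_eventuallyEq he).congr_deriv ?_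
    rw [he.eq_of_nhds]
    ring
  tendsto_logDeriv := by
    refine tendsto_const_nhds.congr' ?_
    filter_upwards [eventually_gt_atTop 0] with x hx0
    have hp := (Real.rpow_pos_of_pos hx0 (α - 1)).ne'
    have hf : fd α 0 x ≠ 0 := (mul_pos (C0_pos hα) (Real.exp_pos _)).ne'
    field_simp
  tendsto_rpow_mul s := by
    have hlim := ((tendsto_rpow_mul_exp_neg_mul_atTop_nhds_zero (s / α) 1 one_pos).comp
      (tendsto_rpow_atTop hα)).const_mul (C0 α)
    rw [mul_zero] at hlim
    refine hlim.congr' ?_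
    filter_upwards [eventually_gt_atTop 0] with x hx0
    simp only [Function.comp_apply, fd, sub_zero, abs_of_pos hx0]
    rw [← Real.rpow_mul hx0.le, mul_div_cancel₀ _ hα.ne']
    ring_nf

theorem setIntegral_Ioi_add_left (f : ℝ → ℝ) (θ T : ℝ) :
    ∫ x in Ioi (θ + T), f x = ∫ x in Ioi T, f (θ + x) := by
  rw [← (measurePreserving_add_left volume θ).setIntegral_preimage_emb
    (measurableEmbedding_addLeft θ)]
  simp

theorem fd_add_left (α θ T : ℝ) : fd α θ (θ + T) = fd α 0 T := by
  simp [fd]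

theorem Ptail_add_left (α θ T : ℝ) : Ptail α θ (θ + T) = Ptail α 0 T := by
  simp only [Ptail, setIntegral_Ioi_add_left, fd_add_left]

theorem hazard_add_left (α θ T : ℝ) : hazard α θ (θ + T) = hazard α 0 T := by
  simp only [hazard, fd_add_left, Ptail_add_left]

theorem gfun_add_left (α θ T : ℝ) : gfun α θ (θ + T) = gfun α 0 T := by
  simp only [gfun, setIntegral_Ioi_add_left, Ptail_add_left]

/-- Asymptotics `h_θ(S) ∼ α(S−θ)^{α−1}`, `g_θ(S) ∼ α(S−θ)^{α−1}`, uniformly in `θ`. -/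
theorem stmt_2 (α : ℝ) (hα : 1/2 ≤ α) :
    (∀ θ : ℝ,
      Tendsto (fun S => hazard α θ S / (α * (S - θ) ^ (α - 1))) atTop (𝓝 1) ∧
      Tendsto (fun S => gfun α θ S / (α * (S - θ) ^ (α - 1))) atTop (𝓝 1)) ∧
    (∀ ε > 0, ∃ T₀ : ℝ, ∀ T ≥ T₀, ∀ θ : ℝ,
      |hazard α θ (θ + T) / (α * T ^ (α - 1)) - 1| ≤ ε ∧
      |gfun α θ (θ + T) / (α * T ^ (α - 1)) - 1| ≤ ε) := by
  have hα0 : 0 < α := by linarith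
  have hh : Tendsto (fun T => hazard α 0 T / (α * T ^ (α - 1))) atTop (𝓝 1) :=
    (hasWeibullDecay_fd hα0).tendsto_ratio hα0
  have hg : Tendsto (fun T => gfun α 0 T / (α * T ^ (α - 1))) atTop (𝓝 1) :=
    ((hasWeibullDecay_fd hα0).integral_Ioi hα0).tendsto_ratio hα0
  refine ⟨fun θ => ?_, fun ε hε => ?_⟩
  · have hshift : Tendsto (fun S : ℝ => S - θ) atTop atTop :=
      tendsto_atTop_add_const_right _ (-θ) tendsto_id
    constructor
    · refine (hh.comp hshift).congr fun S => ?_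
      simp only [Function.comp_apply]
      rw [← hazard_add_left α θ (S - θ), add_sub_cancel]
    · refine (hg.comp hshift).congr fun S => ?_
      simp only [Function.comp_apply]
      rw [← gfun_add_left α θ (S - θ), add_sub_cancel]
  · obtain ⟨T₀, hT₀⟩ := eventually_atTop.mp ((hh.eventually (Metric.closedBall_mem_nhds 1 hε)).and
      (hg.eventually (Metric.closedBall_mem_nhds 1 hε)))
    refine ⟨T₀, fun T hT θ => ?_⟩
    rw [hazard_add_left, gfun_add_left]
    exact hT₀ T hT
end

section
/- Let F₀ be a probability distribution on ℝ with finite mean whose support is unbounded above, with tail probability P₀(S) = ℙ_{X∼F₀}(X > S) and conditional mean μ₀(S) = E_{X∼F₀}[X | X > S], and suppose μ₀(S)/S → 1 as S → ∞. For each γ ∈ (0,1), let S*(γ) > 0 be a solution of the Bellman fixed-point equation (1/γ)·S = (1/(1−γ))·∫_S^∞ P₀(x) dx. Then S*(γ) → ∞ and P₀(S*(γ))/(1−γ) → ∞ as γ → 1⁻. -/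
open MeasureTheory Filter Set Topology

/-- Layer-cake formula for the expected excess of a distribution over a threshold. -/
theorem integral_Ioi_tail_eq_integral_max_sub (μ : Measure ℝ) [IsFiniteMeasure μ]
    (hμ : Integrable (fun x => x) μ) (S : ℝ) :
    ∫ x in Ioi S, μ.real (Ioi x) = ∫ x, max (x - S) 0 ∂μ := by
  have hint : Integrable (fun x => max (x - S) 0) μ := (hμ.sub (integrable_const S)).pos_part
  rw [hint.integral_eq_integral_meas_lt (ae_of_all _ fun x => le_max_right _ _)]
  have hshift := (measurePreserving_add_right (volume : Measure ℝ) S).setIntegral_preimage_emb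
    (measurableEmbedding_addRight S) (fun x => μ.real (Ioi x)) (Ioi S)
  rw [← hshift]
  have hpre : (fun x => x + S) ⁻¹' Ioi S = Ioi 0 := by ext; simp
  rw [hpre]
  refine setIntegral_congr_fun measurableSet_Ioi fun t ht => ?_
  have hset : {a : ℝ | t < max (a - S) 0} = Ioi (t + S) := by
    ext a
    simp [lt_sub_iff_add_lt, not_lt_of_gt (mem_Ioi.1 ht)]
  simp only [hset]

/-- The expected excess over a threshold in terms of the truncated mean. -/
theorem integral_max_sub_eq (μ : Measure ℝ) [IsFiniteMeasure μ]
    (hμ : Integrable (fun x => x) μ) (S : ℝ) :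
    ∫ x, max (x - S) 0 ∂μ = (∫ x in Ioi S, x ∂μ) - S * μ.real (Ioi S) := by
  have hind : (fun x => max (x - S) 0) = (Ioi S).indicator (fun x => x - S) := by
    ext x
    by_cases hx : S < x
    · simp [hx, hx.le]
    · simp [hx, not_lt.1 hx]
  rw [hind, integral_indicator measurableSet_Ioi,
    integral_sub hμ.integrableOn (integrable_const S).integrableOn]
  simp [mul_comm]

/-- The expected excess over a threshold is positive if the tail is. -/
theorem integral_max_sub_pos (μ : Measure ℝ) [IsFiniteMeasure μ]
    (hμ : Integrable (fun x => x) μ) (S : ℝ) (hS : 0 < μ.real (Ioi S)) :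
    0 < ∫ x, max (x - S) 0 ∂μ := by
  have hint : Integrable (fun x => max (x - S) 0) μ := (hμ.sub (integrable_const S)).pos_part
  have hnonneg : 0 ≤ fun x => max (x - S) 0 := fun x => le_max_right _ _
  rw [integral_pos_iff_support_of_nonneg hnonneg hint]
  have hsupp : Function.support (fun x => max (x - S) 0) = Ioi S := by
    ext x
    simp
  rw [hsupp]
  exact (ENNReal.toReal_pos_iff.1 hS).1

/-- The expected excess over a threshold decreases with the threshold. -/
theorem antitone_integral_max_sub (μ : Measure ℝ) [IsFiniteMeasure μ]
    (hμ : Integrable (fun x => x) μ) : Antitone fun S => ∫ x, max (x - S) 0 ∂μ := fun S T h =>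
  integral_mono (hμ.sub (integrable_const T)).pos_part (hμ.sub (integrable_const S)).pos_part
    fun x => max_le_max_right 0 (sub_le_sub_left h x)

/-- If `μ₀(S)/S → 1` as `S → ∞`, then the Bellman threshold `S*(γ)` tends to `∞`
and `P₀(S*(γ))/(1−γ) → ∞` as `γ → 1⁻`. -/
theorem stmt_6 (F0 : Measure ℝ) [IsProbabilityMeasure F0]
    (hmean : Integrable (fun x => x) F0)
    (P0 : ℝ → ℝ) (hP0 : ∀ S, P0 S = (F0 (Set.Ioi S)).toReal)
    (hsupp : ∀ S, 0 < P0 S)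
    (mu0 : ℝ → ℝ) (hmu0 : ∀ S, mu0 S = (∫ x in Set.Ioi S, x ∂F0) / P0 S)
    (hratio : Tendsto (fun S => mu0 S / S) atTop (𝓝 1))
    (Sstar : ℝ → ℝ)
    (hS : ∀ γ ∈ Set.Ioo (0:ℝ) 1, 0 < Sstar γ ∧
      (1/γ) * Sstar γ = (1/(1-γ)) * ∫ x in Set.Ioi (Sstar γ), P0 x) :
    Tendsto Sstar (𝓝[<] (1:ℝ)) atTop ∧
    Tendsto (fun γ => P0 (Sstar γ) / (1 - γ)) (𝓝[<] (1:ℝ)) atTop := by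
  set J : ℝ → ℝ := fun S => ∫ x, max (x - S) 0 ∂F0 with hJ
  have hP : P0 = fun S => F0.real (Ioi S) := funext hP0
  have hJpos (S : ℝ) : 0 < J S :=
    integral_max_sub_pos F0 hmean S (by simpa [hP] using hsupp S)
  have hJmu (S : ℝ) : J S = P0 S * (mu0 S - S) := by
    have h := integral_max_sub_eq F0 hmean S
    rw [hmu0, mul_sub, mul_div_cancel₀ _ (hsupp S).ne', mul_comm (P0 S) S, hP]
    exact h
  have hfix (γ : ℝ) (hγ : γ ∈ Ioo (0 : ℝ) 1) : (1 - γ) * Sstar γ = γ * J (Sstar γ) := by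
    have h := (hS γ hγ).2
    rw [hP, integral_Ioi_tail_eq_integral_max_sub F0 hmean] at h
    have h0 := hγ.1.ne'
    have h1 : 1 - γ ≠ 0 := (sub_pos.2 hγ.2).ne'
    field_simp at h
    linarith
  have hIoo : ∀ᶠ γ in 𝓝[<] (1 : ℝ), γ ∈ Ioo (0 : ℝ) 1 := Ioo_mem_nhdsLT one_pos
  have hStar : Tendsto Sstar (𝓝[<] (1 : ℝ)) atTop := by
    refine tendsto_atTop.2 fun M => ?_
    have hlim : Tendsto (fun γ : ℝ => γ * J M - (1 - γ) * M) (𝓝[<] 1) (𝓝 (J M)) := by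
      have hcont : Continuous fun γ : ℝ => γ * J M - (1 - γ) * M := by fun_prop
      simpa using (hcont.tendsto 1).mono_left nhdsWithin_le_nhds
    filter_upwards [hIoo, hlim.eventually_const_lt (hJpos M)] with γ hγ hlt
    by_contra! hM
    have hanti : J M ≤ J (Sstar γ) := antitone_integral_max_sub F0 hmean hM.le
    have h1 := mul_le_mul_of_nonneg_left hanti hγ.1.le
    have h2 := mul_le_mul_of_nonneg_left hM.le (sub_pos.2 hγ.2).le
    linarith [hfix γ hγ]
  refine ⟨hStar, ?_⟩
  have hid : Tendsto (fun γ : ℝ => γ) (𝓝[<] 1) (𝓝 1) := nhdsWithin_le_nhds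
  have hzero : Tendsto (fun γ => γ * (mu0 (Sstar γ) / Sstar γ - 1)) (𝓝[<] 1) (𝓝 0) := by
    simpa using hid.mul ((hratio.comp hStar).sub_const 1)
  have hprod (γ : ℝ) (hγ : γ ∈ Ioo (0 : ℝ) 1) :
      P0 (Sstar γ) / (1 - γ) * (γ * (mu0 (Sstar γ) / Sstar γ - 1)) = 1 := by
    have h := hfix γ hγ
    rw [hJmu] at h
    have h0 := (hS γ hγ).1.ne'
    have h1 : 1 - γ ≠ 0 := (sub_pos.2 hγ.2).ne'
    field_simp
    linarith
  have hpos : ∀ᶠ γ in 𝓝[<] (1 : ℝ), γ * (mu0 (Sstar γ) / Sstar γ - 1) ∈ Ioi (0 : ℝ) := by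
    filter_upwards [hIoo] with γ hγ
    have hdiv : 0 < P0 (Sstar γ) / (1 - γ) := div_pos (hsupp _) (sub_pos.2 hγ.2)
    exact pos_of_mul_pos_right (by rw [hprod γ hγ]; exact one_pos) hdiv.le
  have hinv := tendsto_inv_nhdsGT_zero.comp (tendsto_nhdsWithin_iff.2 ⟨hzero, hpos⟩)
  refine hinv.congr' ?_
  filter_upwards [hIoo] with γ hγ
  exact (eq_inv_of_mul_eq_one_left (hprod γ hγ)).symm
end

section
/- Let α ≥ 1/2 and let f : (0,1) → [0,∞) satisfy f(γ)/(log(1/(1−γ)))^{1/α} → 0 as γ → 1⁻. Then for every θ₀ ∈ ℝ, sup_{θ ∈ [θ₀−f(γ), θ₀+f(γ)]} |(S*(θ,γ) − θ)/(log(1/(1−γ)))^{1/α} − 1| → 0 as γ → 1⁻. -/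
open MeasureTheory Filter Set Topology

theorem integrableOn_Ioi_exp_neg_mul_rpow {α a : ℝ} (hα : 0 < α) (ha : 0 < a) :
    IntegrableOn (fun x : ℝ => Real.exp (-(a * x ^ α))) (Ioi 0) := by
  simpa using integrableOn_rpow_mul_exp_neg_mul_rpow (s := 0) (by norm_num) hα ha

theorem integrable_exp_neg_abs_rpow {α : ℝ} (hα : 0 < α) :
    Integrable fun x : ℝ => Real.exp (-(|x| ^ α)) := by
  have hpos : IntegrableOn (fun x : ℝ => Real.exp (-(|x| ^ α))) (Ioi 0) := by
    refine (integrableOn_Ioi_exp_neg_mul_rpow hα one_pos).congr_fun (fun x hx => ?_)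
      measurableSet_Ioi
    simp [abs_of_pos (mem_Ioi.1 hx)]
  have hneg : IntegrableOn (fun x : ℝ => Real.exp (-(|x| ^ α))) (Iic 0) := by
    have h := (integrableOn_Ici_iff_integrableOn_Ioi).2 hpos
    rw [← neg_zero] at h
    simpa using h.comp_neg_Iic
  rw [← integrableOn_univ, ← Iic_union_Ioi (a := (0 : ℝ))]
  exact hneg.union hpos

theorem integrable_fd_zero {α : ℝ} (hα : 0 < α) : Integrable (fd α 0) := by
  have h : fd α 0 = fun x => C0 α * Real.exp (-(|x| ^ α)) := by
    ext x
    rw [fd, sub_zero]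
  rw [h]
  exact (integrable_exp_neg_abs_rpow hα).const_mul _

theorem fd_nonneg {α : ℝ} (hα : 0 < α) (θ x : ℝ) : 0 ≤ fd α θ x :=
  mul_nonneg (C0_pos hα).le (Real.exp_pos _).le

theorem Ptail_nonneg {α : ℝ} (hα : 0 < α) (θ S : ℝ) : 0 ≤ Ptail α θ S :=
  integral_nonneg fun x => fd_nonneg hα θ x

theorem setIntegral_Ioi_comp_sub_right (g : ℝ → ℝ) (S θ : ℝ) :
    ∫ x in Ioi S, g (x - θ) = ∫ x in Ioi (S - θ), g x := by
  have h := (measurePreserving_sub_right volume θ).setIntegral_preimage_emb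
    (MeasurableEquiv.subRight θ).measurableEmbedding g (Ioi (S - θ))
  simpa using h

theorem Ptail_eq_Ptail_zero (α θ S : ℝ) : Ptail α θ S = Ptail α 0 (S - θ) := by
  simpa [Ptail, fd] using setIntegral_Ioi_comp_sub_right (fd α 0) S θ

theorem setIntegral_Ptail_eq (α θ S : ℝ) :
    ∫ x in Ioi S, Ptail α θ x = ∫ x in Ioi (S - θ), Ptail α 0 x := by
  simp_rw [Ptail_eq_Ptail_zero α θ]
  exact setIntegral_Ioi_comp_sub_right (Ptail α 0) S θ

/-- Tails of the stretched exponential, with an arbitrarily small loss in the rate. -/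
theorem exists_setIntegral_Ioi_exp_neg_mul_rpow_le {α a b : ℝ} (hα : 0 < α) (hb : 0 < b)
    (hba : b < a) :
    ∃ K, 0 ≤ K ∧ ∀ t, 0 ≤ t →
      ∫ x in Ioi t, Real.exp (-(a * x ^ α)) ≤ K * Real.exp (-(b * t ^ α)) := by
  have hI := integrableOn_Ioi_exp_neg_mul_rpow hα (sub_pos.2 hba)
  refine ⟨∫ x in Ioi 0, Real.exp (-((a - b) * x ^ α)),
    integral_nonneg fun x => (Real.exp_pos _).le, fun t ht => ?_⟩
  have hsub : Ioi t ⊆ Ioi 0 := Ioi_subset_Ioi ht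
  calc ∫ x in Ioi t, Real.exp (-(a * x ^ α))
      ≤ ∫ x in Ioi t, Real.exp (-((a - b) * x ^ α)) * Real.exp (-(b * t ^ α)) := by
        refine setIntegral_mono_on
          ((integrableOn_Ioi_exp_neg_mul_rpow hα (hb.trans hba)).mono_set hsub)
          ((hI.mono_set hsub).mul_const _) measurableSet_Ioi fun x hx => ?_
        rw [← Real.exp_add]
        have h := Real.rpow_le_rpow ht (mem_Ioi.1 hx).le hα.le
        exact Real.exp_le_exp.2 (by nlinarith)
    _ = (∫ x in Ioi t, Real.exp (-((a - b) * x ^ α))) * Real.exp (-(b * t ^ α)) :=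
        integral_mul_const _ _
    _ ≤ _ := by
        refine mul_le_mul_of_nonneg_right ?_ (Real.exp_pos _).le
        exact setIntegral_mono_set hI (ae_of_all _ fun x => (Real.exp_pos _).le)
          hsub.eventuallyLE

theorem exists_setIntegral_Ptail_le {α b : ℝ} (hα : 0 < α) (hb : 0 < b) (hb1 : b < 1) :
    ∃ K, 0 ≤ K ∧ ∀ t, 0 ≤ t →
      ∫ x in Ioi t, Ptail α 0 x ≤ K * Real.exp (-(b * t ^ α)) := by
  obtain ⟨d, hbd, hd1⟩ := exists_between hb1
  have hd := hb.trans hbd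
  obtain ⟨K₁, hK₁, h₁⟩ := exists_setIntegral_Ioi_exp_neg_mul_rpow_le hα hd hd1
  obtain ⟨K₂, hK₂, h₂⟩ := exists_setIntegral_Ioi_exp_neg_mul_rpow_le hα hb hbd
  have hC := C0_pos hα
  have hP : ∀ t, 0 ≤ t → Ptail α 0 t ≤ C0 α * K₁ * Real.exp (-(d * t ^ α)) := by
    intro t ht
    have h : Ptail α 0 t = C0 α * ∫ x in Ioi t, Real.exp (-(1 * x ^ α)) := by
      rw [Ptail, ← integral_const_mul]
      refine setIntegral_congr_fun measurableSet_Ioi fun x hx => ?_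
      simp [fd, abs_of_pos (ht.trans_lt (mem_Ioi.1 hx))]
    rw [h, mul_assoc]
    exact mul_le_mul_of_nonneg_left (h₁ t ht) hC.le
  refine ⟨C0 α * K₁ * K₂, by positivity, fun t ht => ?_⟩
  calc ∫ x in Ioi t, Ptail α 0 x
      ≤ ∫ x in Ioi t, C0 α * K₁ * Real.exp (-(d * x ^ α)) := by
        refine integral_mono_of_nonneg (ae_of_all _ fun x => Ptail_nonneg hα 0 x)
          (((integrableOn_Ioi_exp_neg_mul_rpow hα hd).mono_set
            (Ioi_subset_Ioi ht)).const_mul _) ?_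
        filter_upwards [ae_restrict_mem measurableSet_Ioi] with x hx
        exact hP x (ht.trans (mem_Ioi.1 hx).le)
    _ = C0 α * K₁ * ∫ x in Ioi t, Real.exp (-(d * x ^ α)) := integral_const_mul _ _
    _ ≤ _ := by
        rw [mul_assoc _ K₂]
        exact mul_le_mul_of_nonneg_left (h₂ t ht) (by positivity)

theorem le_setIntegral_Ioi_of_forall_mem_Ioc {g : ℝ → ℝ} {c s t : ℝ} (hg : ∀ x, 0 ≤ g x)
    (hint : IntegrableOn g (Ioi s)) (hst : s ≤ t) (h : ∀ x ∈ Ioc t (t + 1), c ≤ g x) :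
    c ≤ ∫ x in Ioi s, g x := by
  have hsub : Ioc t (t + 1) ⊆ Ioi s := fun x hx => hst.trans_lt hx.1
  calc c = c * volume.real (Ioc t (t + 1)) := by simp
    _ ≤ ∫ x in Ioc t (t + 1), g x :=
        setIntegral_ge_of_const_le_real measurableSet_Ioc (by simp) h (hint.mono_set hsub)
    _ ≤ _ := setIntegral_mono_set hint (ae_of_all _ hg) hsub.eventuallyLE

theorem le_setIntegral_Ptail {α s t : ℝ} (hα : 0 < α) (hst : s ≤ t) (ht : 0 ≤ t)
    (hint : IntegrableOn (Ptail α 0) (Ioi s)) :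
    C0 α * Real.exp (-((t + 2) ^ α)) ≤ ∫ x in Ioi s, Ptail α 0 x := by
  refine le_setIntegral_Ioi_of_forall_mem_Ioc (Ptail_nonneg hα 0) hint hst fun x hx => ?_
  refine le_setIntegral_Ioi_of_forall_mem_Ioc (fd_nonneg hα 0)
    (integrable_fd_zero hα).integrableOn le_rfl fun y hy => ?_
  have hy0 : 0 ≤ y := by linarith [hx.1, hy.1]
  have := (C0_pos hα).le
  rw [fd, sub_zero, abs_of_nonneg hy0]
  gcongr
  linarith [hx.2, hy.2]

theorem tendsto_log_one_div_one_sub :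
    Tendsto (fun γ : ℝ => Real.log (1 / (1 - γ))) (𝓝[<] 1) atTop := by
  refine Real.tendsto_log_atTop.comp ?_
  simp_rw [one_div]
  refine tendsto_inv_nhdsGT_zero.comp (tendsto_nhdsWithin_iff.2 ⟨?_, ?_⟩)
  · have h : Tendsto (fun γ : ℝ => 1 - γ) (𝓝 1) (𝓝 (1 - 1)) := tendsto_id.const_sub 1
    rw [sub_self] at h
    exact h.mono_left nhdsWithin_le_nhds
  · filter_upwards [self_mem_nhdsWithin] with γ hγ
    exact sub_pos.2 (mem_Iio.1 hγ)

/-- Uniform approximation of the optimal threshold: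
`(S*(θ,γ) − θ)/(log(1/(1−γ)))^{1/α} → 1` uniformly for `θ ∈ [θ₀−f(γ), θ₀+f(γ)]`. -/
theorem stmt_7 (α : ℝ) (hα : 1/2 ≤ α)
    (Sstar : ℝ → ℝ → ℝ)
    (hS : ∀ θ : ℝ, ∀ γ ∈ Set.Ioo (0:ℝ) 1,
      0 < Sstar θ γ ∧
      ((1-γ)/γ) * Sstar θ γ = (∫ x in Set.Ioi (Sstar θ γ), Ptail α θ x) ∧
      ∀ S, 0 < S → ((1-γ)/γ) * S = (∫ x in Set.Ioi S, Ptail α θ x) → S = Sstar θ γ)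
    (f : ℝ → ℝ) (hf0 : ∀ γ, 0 ≤ f γ)
    (hf : Tendsto (fun γ => f γ / (Real.log (1/(1-γ))) ^ (1/α)) (𝓝[<] (1:ℝ)) (𝓝 0))
    (θ₀ : ℝ) :
    ∀ c > 0, ∀ᶠ γ in 𝓝[<] (1:ℝ), ∀ θ ∈ Set.Icc (θ₀ - f γ) (θ₀ + f γ),
      |(Sstar θ γ - θ) / (Real.log (1/(1-γ))) ^ (1/α) - 1| ≤ c := by
  intro c₀ hc₀
  have hα0 : 0 < α := by linarith
  obtain ⟨c, hc, hcc, hc1⟩ : ∃ c, 0 < c ∧ c ≤ c₀ ∧ c < 1 :=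
    ⟨min c₀ (1 / 2), by positivity, min_le_left _ _, (min_le_right _ _).trans_lt (by norm_num)⟩
  have hd : 1 < (1 + c) ^ α := Real.one_lt_rpow (by linarith) hα0
  have he : (1 - c / 2) ^ α < 1 := Real.rpow_lt_one (by linarith) (by linarith) hα0
  obtain ⟨b, hdb, hb1⟩ := exists_between (inv_lt_one_of_one_lt₀ hd)
  have hb0 : 0 < b := (inv_pos.2 (by linarith)).trans hdb
  have hδ : 0 < b * (1 + c) ^ α - 1 := by
    have := (inv_lt_iff_one_lt_mul₀ (by linarith : 0 < (1 + c) ^ α)).1 hdb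
    linarith
  obtain ⟨K, hK, hG⟩ := exists_setIntegral_Ptail_le hα0 hb0 hb1
  have hL := tendsto_log_one_div_one_sub
  have hR := (tendsto_rpow_atTop (one_div_pos.2 hα0)).comp hL
  have hupper : ∀ᶠ L in atTop, K * Real.exp (-(b * (1 + c) ^ α - 1) * L) < 1 := by
    have h := (tendsto_rpow_mul_exp_neg_mul_atTop_nhds_zero 0 _ hδ).const_mul K
    simp only [Real.rpow_zero, one_mul, mul_zero] at h
    exact h.eventually_lt_const one_pos
  have hlower : ∀ᶠ L in atTop,
      2 * (L ^ (1 / α) * Real.exp (-(1 - (1 - c / 2) ^ α) * L)) < C0 α := by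
    have h := (tendsto_rpow_mul_exp_neg_mul_atTop_nhds_zero (1 / α) _ (sub_pos.2 he)).const_mul 2
    rw [mul_zero] at h
    exact h.eventually_lt_const (C0_pos hα0)
  filter_upwards [hL.eventually hupper, hL.eventually hlower, hL.eventually_gt_atTop 0,
    hR.eventually_ge_atTop 1, hR.eventually_ge_atTop (4 / c),
    hR.eventually_ge_atTop (|θ₀| / (c / 4)),
    hf.eventually_le_const (by positivity : 0 < c / 4),
    Ioo_mem_nhdsLT (by norm_num : (1 / 2 : ℝ) < 1)] with γ hU hW hL0 hR1 hR4 hRθ hfR hγ θ hθ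
  obtain ⟨hS0, hSeq, -⟩ := hS θ γ ⟨by linarith [hγ.1], hγ.2⟩
  have hγ0 : 0 < γ := by linarith [hγ.1]
  have hγ1 : 0 < 1 - γ := sub_pos.2 hγ.2
  have hexp : 1 - γ = Real.exp (-Real.log (1 / (1 - γ))) := by
    rw [one_div, Real.log_inv, neg_neg, Real.exp_log hγ1]
  simp only [Function.comp_apply] at hR1 hR4 hRθ
  rw [setIntegral_Ptail_eq] at hSeq
  set L := Real.log (1 / (1 - γ))
  have hRL : (L ^ (1 / α)) ^ α = L := by
    rw [one_div, Real.rpow_inv_rpow hL0.le hα0.ne']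
  set R := L ^ (1 / α)
  set S := Sstar θ γ
  have hR0 : 0 < R := by linarith
  rw [div_le_iff₀ hR0] at hfR
  rw [div_le_iff₀' (by positivity)] at hR4
  rw [div_le_iff₀' (by positivity)] at hRθ
  have hθabs := abs_le.1 hRθ
  suffices h : (1 - c) * R ≤ S - θ ∧ S - θ ≤ (1 + c) * R by
    refine le_trans (abs_le.2 ⟨?_, ?_⟩) hcc
    · linarith [(le_div_iff₀ hR0).2 h.1]
    · linarith [(div_le_iff₀ hR0).2 h.2]
  constructor
  · by_contra! h
    have hint : IntegrableOn (Ptail α 0) (Ioi (S - θ)) :=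
      Integrable.of_integral_ne_zero (by rw [← hSeq]; positivity)
    have hlow := le_setIntegral_Ptail hα0 h.le (mul_nonneg (by linarith) hR0.le) hint
    have hpow : ((1 - c) * R + 2) ^ α ≤ (1 - c / 2) ^ α * L := by
      rw [← hRL, ← Real.mul_rpow (by linarith) hR0.le]
      refine Real.rpow_le_rpow ?_ (by nlinarith) hα0.le
      nlinarith
    have hSR : (1 - γ) / γ * S ≤ 2 * R * Real.exp (-L) := by
      rw [← hexp, div_mul_eq_mul_div, div_le_iff₀ hγ0]
      have : S ≤ R := by nlinarith [hθ.2]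
      nlinarith [mul_le_mul_of_nonneg_left this hγ1.le, mul_pos hγ1 hR0, hγ.1]
    have hlow' : C0 α * Real.exp (-((1 - c / 2) ^ α * L)) ≤
        C0 α * Real.exp (-(((1 - c) * R + 2) ^ α)) :=
      mul_le_mul_of_nonneg_left (Real.exp_le_exp.2 (neg_le_neg hpow)) (C0_pos hα0).le
    have hmul := mul_lt_mul_of_pos_right hW (Real.exp_pos (-((1 - c / 2) ^ α * L)))
    rw [mul_assoc, mul_assoc, ← Real.exp_add,
      show -(1 - (1 - c / 2) ^ α) * L + -((1 - c / 2) ^ α * L) = -L by ring] at hmul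
    linarith
  · by_contra! h
    have hT0 : 0 ≤ (1 + c) * R := by positivity
    have hGT := hG (S - θ) (hT0.trans h.le)
    have hpow : (1 + c) ^ α * L ≤ (S - θ) ^ α := by
      rw [← hRL, ← Real.mul_rpow (by linarith) hR0.le]
      exact Real.rpow_le_rpow hT0 h.le hα0.le
    have hSR : Real.exp (-L) ≤ (1 - γ) / γ * S := by
      rw [← hexp, div_mul_eq_mul_div, le_div_iff₀ hγ0]
      have : 1 ≤ S := by nlinarith [hθ.1]
      nlinarith [hγ.2]
    have hGT' : K * Real.exp (-(b * (S - θ) ^ α)) ≤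
        K * Real.exp (-(b * ((1 + c) ^ α * L))) :=
      mul_le_mul_of_nonneg_left
        (Real.exp_le_exp.2 (neg_le_neg (mul_le_mul_of_nonneg_left hpow hb0.le))) hK
    have hmul := mul_lt_mul_of_pos_right hU (Real.exp_pos (-L))
    rw [mul_assoc, ← Real.exp_add,
      show -(b * (1 + c) ^ α - 1) * L + -L = -(b * ((1 + c) ^ α * L)) by ring] at hmul
    linarith
end

section
/- Let F₀ be a probability distribution on ℝ with finite mean whose support is unbounded above, with tail probability P₀(S) = ℙ_{X∼F₀}(X > S) and conditional mean μ₀(S) = E_{X∼F₀}[X | X > S], and suppose μ₀(S)/S → 1 as S → ∞. For each γ ∈ (0,1), let S*₀(γ) > 0 be the solution of the Bellman fixed-point equation (1/γ)·S = (1/(1−γ))·∫_S^∞ P₀(x) dx, and let S_γ be thresholds with S_γ/S*₀(γ) → 1 as γ → 1⁻. Define V_γ(S) = μ₀(S)·P₀(S)/((1−γ) + γ·P₀(S)) and the relative regret R(γ) = 1 − V_γ(S_γ)/V_γ(S*₀(γ)). Then: (i) if P₀(S_γ)/(1−γ) → ∞, then R(γ) → 0 as γ → 1⁻; (ii) if P₀(S_γ)/(1−γ)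 → 0, then R(γ) → 1 as γ → 1⁻. -/
open MeasureTheory Filter Set Topology

/-- The integrated tail above `S` is the expected excess over `S`. -/
lemma setIntegral_Ioi_tail_eq_integral_max {μ : Measure ℝ} [IsFiniteMeasure μ]
    (hμ : Integrable (fun x => x) μ) (S : ℝ) :
    ∫ x in Ioi S, (μ (Ioi x)).toReal = ∫ x, max (x - S) 0 ∂μ := by
  have hint : Integrable (fun x => max (x - S) 0) μ :=
    (hμ.sub (integrable_const S)).pos_part
  rw [hint.integral_eq_integral_meas_lt (Eventually.of_forall fun x => le_max_right _ _)]
  have hpre : (fun t : ℝ => t + S) ⁻¹' Ioi S = Ioi 0 := by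
    ext t; simp
  have hshift := (measurePreserving_add_right (volume : Measure ℝ) S).setIntegral_preimage_emb
    (measurableEmbedding_addRight S) (fun x => (μ (Ioi x)).toReal) (Ioi S)
  rw [hpre] at hshift
  rw [← hshift]
  refine setIntegral_congr_fun measurableSet_Ioi fun t ht => ?_
  have ht0 : (0 : ℝ) < t := ht
  have hset : Ioi (t + S) = {x : ℝ | t < max (x - S) 0} := by
    ext x
    simp [not_lt.mpr ht0.le, lt_sub_iff_add_lt]
  simp only [hset, Measure.real]

/-- The partial mean above `S` splits into the threshold part and the integrated tail. -/
lemma setIntegral_Ioi_id_eq_mul_tail_add {μ : Measure ℝ} [IsFiniteMeasure μ]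
    (hμ : Integrable (fun x => x) μ) (S : ℝ) :
    ∫ x in Ioi S, x ∂μ = S * (μ (Ioi S)).toReal + ∫ x in Ioi S, (μ (Ioi x)).toReal := by
  have hmax : ∫ x, max (x - S) 0 ∂μ = ∫ x in Ioi S, (x - S) ∂μ := by
    rw [← integral_indicator measurableSet_Ioi]
    refine integral_congr_ae (Eventually.of_forall fun x => ?_)
    by_cases hx : S < x
    · simp [hx, hx.le]
    · simp [hx, not_lt.mp hx]
  rw [setIntegral_Ioi_tail_eq_integral_max hμ, hmax,
    integral_sub hμ.integrableOn (integrable_const S)]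
  simp [Measure.real]
  ring

/-- Below the level `B`, the integrated tail is at least the mass above `B + 1`. -/
lemma tail_le_setIntegral_Ioi_tail {μ : Measure ℝ} [IsFiniteMeasure μ]
    (hμ : Integrable (fun x => x) μ) {S B : ℝ} (hSB : S ≤ B) :
    (μ (Ioi (B + 1))).toReal ≤ ∫ x in Ioi S, (μ (Ioi x)).toReal := by
  have hint : Integrable (fun x => max (x - S) 0) μ :=
    (hμ.sub (integrable_const S)).pos_part
  rw [setIntegral_Ioi_tail_eq_integral_max hμ]
  change μ.real (Ioi (B + 1)) ≤ _
  rw [← integral_indicator_one measurableSet_Ioi]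
  refine integral_mono ((integrable_const (1 : ℝ)).indicator measurableSet_Ioi) hint fun x => ?_
  by_cases hx : B + 1 < x
  · simp only [mem_Ioi, hx, indicator_of_mem, Pi.one_apply]
    exact le_max_of_le_left (by linarith)
  · simp [hx]

/-- Positive solutions of the Bellman fixed-point equation tend to infinity as the discount
factor tends to one. -/
lemma tendsto_bellman_threshold_atTop {μ : Measure ℝ} [IsFiniteMeasure μ]
    (hμ : Integrable (fun x => x) μ) (hpos : ∀ S, 0 < (μ (Ioi S)).toReal) {s : ℝ → ℝ}
    (hs : ∀ γ ∈ Ioo (0 : ℝ) 1, (1 / γ) * s γ =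
      (1 / (1 - γ)) * ∫ x in Ioi (s γ), (μ (Ioi x)).toReal) :
    Tendsto s (𝓝[<] (1 : ℝ)) atTop := by
  rw [tendsto_atTop]
  intro B
  have hlim : Tendsto (fun γ : ℝ => γ * (μ (Ioi (B + 1))).toReal - (1 - γ) * B)
      (𝓝[<] (1 : ℝ)) (𝓝 (μ (Ioi (B + 1))).toReal) := by
    refine tendsto_nhdsWithin_of_tendsto_nhds ?_
    have hc : Continuous fun γ : ℝ => γ * (μ (Ioi (B + 1))).toReal - (1 - γ) * B := by fun_prop
    simpa using hc.tendsto 1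
  filter_upwards [Ioo_mem_nhdsLT (zero_lt_one' ℝ), hlim.eventually (lt_mem_nhds (hpos (B + 1)))]
    with γ hγ hlt
  by_contra! hB
  have htail := tail_le_setIntegral_Ioi_tail hμ hB.le
  have heq := hs γ hγ
  have h0 := hγ.1
  have h1 : 0 < 1 - γ := sub_pos.mpr hγ.2
  field_simp at heq
  nlinarith [mul_le_mul_of_nonneg_left htail h0.le, mul_lt_mul_of_pos_left hB h1]

/-- Phase transition for the relative regret of a threshold policy whose thresholds
are asymptotically equivalent to the Bellman thresholds. -/
theorem stmt_14 (F0 : Measure ℝ) [IsProbabilityMeasure F0]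
    (hmean : Integrable (fun x => x) F0)
    (P0 : ℝ → ℝ) (hP0 : ∀ S, P0 S = (F0 (Set.Ioi S)).toReal)
    (hsupp : ∀ S, 0 < P0 S)
    (mu0 : ℝ → ℝ) (hmu0 : ∀ S, mu0 S = (∫ x in Set.Ioi S, x ∂F0) / P0 S)
    (hratio : Tendsto (fun S => mu0 S / S) atTop (𝓝 1))
    (Sstar0 : ℝ → ℝ)
    (hS : ∀ γ ∈ Set.Ioo (0:ℝ) 1, 0 < Sstar0 γ ∧
      (1/γ) * Sstar0 γ = (1/(1-γ)) * ∫ x in Set.Ioi (Sstar0 γ), P0 x)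
    (Sg : ℝ → ℝ) (hSg : Tendsto (fun γ => Sg γ / Sstar0 γ) (𝓝[<] (1:ℝ)) (𝓝 1))
    (V : ℝ → ℝ → ℝ) (hV : ∀ γ S, V γ S = mu0 S * P0 S / ((1-γ) + γ * P0 S))
    (R : ℝ → ℝ) (hR : ∀ γ, R γ = 1 - V γ (Sg γ) / V γ (Sstar0 γ)) :
    (Tendsto (fun γ => P0 (Sg γ) / (1-γ)) (𝓝[<] (1:ℝ)) atTop →
      Tendsto R (𝓝[<] (1:ℝ)) (𝓝 0)) ∧
    (Tendsto (fun γ => P0 (Sg γ) / (1-γ)) (𝓝[<] (1:ℝ)) (𝓝 0) →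
      Tendsto R (𝓝[<] (1:ℝ)) (𝓝 1)) := by
  obtain rfl : P0 = fun S => (F0 (Ioi S)).toReal := funext hP0
  set P0 : ℝ → ℝ := fun S => (F0 (Ioi S)).toReal
  have hSinf : Tendsto Sstar0 (𝓝[<] (1 : ℝ)) atTop :=
    tendsto_bellman_threshold_atTop hmean hsupp fun γ hγ => (hS γ hγ).2
  have hmem : ∀ᶠ γ in 𝓝[<] (1 : ℝ), γ ∈ Ioo (0 : ℝ) 1 := Ioo_mem_nhdsLT zero_lt_one
  have hSginf : Tendsto Sg (𝓝[<] (1 : ℝ)) atTop := by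
    refine (hSg.pos_mul_atTop one_pos hSinf).congr' ?_
    filter_upwards [hmem] with γ hγ
    exact div_mul_cancel₀ _ (hS γ hγ).1.ne'
  have hVstar : ∀ γ ∈ Ioo (0 : ℝ) 1, V γ (Sstar0 γ) = Sstar0 γ / γ := by
    intro γ hγ
    have heq := (hS γ hγ).2
    have h0 := hγ.1
    have h1 : 0 < 1 - γ := sub_pos.mpr hγ.2
    have hp := hsupp (Sstar0 γ)
    have hden : 0 < (1 - γ) + γ * P0 (Sstar0 γ) := by positivity
    have hsplit := setIntegral_Ioi_id_eq_mul_tail_add hmean (Sstar0 γ)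
    rw [hV, hmu0, div_mul_cancel₀ _ hp.ne', div_eq_div_iff hden.ne' h0.ne', hsplit]
    field_simp at heq
    linear_combination -heq
  have hgamma : Tendsto (fun γ : ℝ => γ) (𝓝[<] (1 : ℝ)) (𝓝 1) :=
    tendsto_nhdsWithin_of_tendsto_nhds tendsto_id
  have hfactor : ∀ᶠ γ in 𝓝[<] (1 : ℝ),
      1 - (mu0 (Sg γ) / Sg γ) * (Sg γ / Sstar0 γ) *
        (1 - (1 + γ * (P0 (Sg γ) / (1 - γ)))⁻¹) = R γ := by
    filter_upwards [hmem, hSginf.eventually_gt_atTop 0] with γ hγ hSgpos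
    have h0 := hγ.1
    have h1 : 0 < 1 - γ := sub_pos.mpr hγ.2
    have hp := hsupp (Sg γ)
    have hs := (hS γ hγ).1
    have hden : 0 < (1 - γ) + γ * P0 (Sg γ) := by positivity
    have hinv : 1 - (1 + γ * (P0 (Sg γ) / (1 - γ)))⁻¹ =
        γ * P0 (Sg γ) / ((1 - γ) + γ * P0 (Sg γ)) := by
      have : 1 + γ * (P0 (Sg γ) / (1 - γ)) = ((1 - γ) + γ * P0 (Sg γ)) / (1 - γ) := by
        field_simp
      rw [this, inv_div, eq_div_iff hden.ne', sub_mul, div_mul_cancel₀ _ hden.ne']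
      ring
    rw [hR, hVstar γ hγ, hV, hinv]
    field_simp
  have hlim : ∀ l : ℝ, Tendsto (fun γ => (1 + γ * (P0 (Sg γ) / (1 - γ)))⁻¹)
      (𝓝[<] (1 : ℝ)) (𝓝 l) → Tendsto R (𝓝[<] (1 : ℝ)) (𝓝 l) := by
    intro l hl
    have h := (((hratio.comp hSginf).mul hSg).mul (hl.const_sub 1)).const_sub 1
    simp only [one_mul, sub_sub_cancel] at h
    exact h.congr' hfactor
  refine ⟨fun h => hlim 0 ?_, fun h => hlim 1 ?_⟩
  · exact tendsto_inv_atTop_zero.comp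
      (tendsto_atTop_add_const_left _ 1 (hgamma.pos_mul_atTop one_pos h))
  · simpa using ((hgamma.mul h).const_add 1).inv₀ (by norm_num)
end
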